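/- arXiv:1409.7585 — 2 statements merged into one kernel-verified Lean document; each statement's English description precedes it below -/
import Mathlib

section
/- Let n ≥ 1 and let p ∈ S_n, where S_n ⊆ [1/2,∞)ⁿ is the set of all p = (p₁,…,p_n) for which there exist reals b₁,…,b_n with 1 ≤ b_i ≤ b_n for i = 1,…,n−1 such that every coordinate p_j belongs to {b₁,…,b_{n−1}, b_n/2}. Then a holomorphic map f : 𝔻 → E(p) is a weak m-extremal if and only if it is an m-extremal. (In particular this holds in every symmetric convex complex ellipsoid E(p₀,…,p₀) with p₀ ≥ 1/2 and in every complex ellipsoid with all p_j ≥ 1.) -/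
open Complex Metric Set Filter

noncomputable section

/-- The open unit disc `𝔻` in `ℂ`. -/
def unitDisc : Set ℂ := Metric.ball (0 : ℂ) 1

/-- The Möbius function `m_α(λ) = (λ - α)/(1 - conj α · λ)`. -/
def mobius (a z : ℂ) : ℂ := (z - a) / (1 - (starRingEnd ℂ) a * z)

/-- `B` agrees on the unit disc with a finite Blaschke product
`ζ · ∏_{j=1}^k m_{α_j}` of degree `k` (here `ζ ∈ 𝕋`, `α_j ∈ 𝔻`). -/
def IsBlaschkeOn (B : ℂ → ℂ) (k : ℕ) : Prop :=
  ∃ (ζ : ℂ) (α : Fin k → ℂ), ‖ζ‖ = 1 ∧ (∀ j, ‖α j‖ < 1) ∧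
    ∀ z ∈ unitDisc, B z = ζ * ∏ j, mobius (α j) z

variable {E : Type*} [NormedAddCommGroup E] [NormedSpace ℂ E]

/-- `f` is a weak `m`-extremal for the nodes `lam` with respect to the domain `D`:
there is no map `h`, holomorphic on an open neighborhood of the closed unit disc
with values in `D`, interpolating `f` at all the nodes. -/
def WeakExtremalFor (D : Set E) (f : ℂ → E) {m : ℕ} (lam : Fin m → ℂ) : Prop :=
  ¬ ∃ (U : Set ℂ) (h : ℂ → E), IsOpen U ∧ Metric.closedBall (0 : ℂ) 1 ⊆ U ∧
      DifferentiableOn ℂ h U ∧ Set.MapsTo h U D ∧ ∀ j, h (lam j) = f (lam j)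

/-- `f` is a weak `m`-extremal of `D`: it is a weak `m`-extremal for some
pairwise distinct nodes in the unit disc. -/
def IsWeakExtremal (D : Set E) (f : ℂ → E) (m : ℕ) : Prop :=
  ∃ lam : Fin m → ℂ, Function.Injective lam ∧ (∀ j, lam j ∈ unitDisc) ∧
    WeakExtremalFor D f lam

/-- `f` is an `m`-extremal of `D`: it is a weak `m`-extremal for every choice of
pairwise distinct nodes in the unit disc. -/
def IsExtremal (D : Set E) (f : ℂ → E) (m : ℕ) : Prop :=
  ∀ lam : Fin m → ℂ, Function.Injective lam → (∀ j, lam j ∈ unitDisc) →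
    WeakExtremalFor D f lam

/-- `f` is an `m`-geodesic of `D`: there is a holomorphic `F : D → 𝔻` such that
`F ∘ f` is a non-constant Blaschke product of degree at most `m - 1`. -/
def IsGeodesic (D : Set E) (f : ℂ → E) (m : ℕ) : Prop :=
  ∃ F : E → ℂ, DifferentiableOn ℂ F D ∧ Set.MapsTo F D unitDisc ∧
    ∃ k : ℕ, 1 ≤ k ∧ k ≤ m - 1 ∧ IsBlaschkeOn (fun z => F (f z)) k

/-- A domain `D ⊆ ℂⁿ` is `k`-balanced (quasi-balanced) if
`(λ^{k₁} z₁, …, λ^{k_n} z_n) ∈ D` for all `λ` in the closed unit disc, `z ∈ D`. -/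
def QuasiBalanced {n : ℕ} (k : Fin n → ℕ) (D : Set (Fin n → ℂ)) : Prop :=
  ∀ l : ℂ, ‖l‖ ≤ 1 → ∀ z ∈ D, (fun j => l ^ k j * z j) ∈ D

/-- The complex ellipsoid `E(p) = {z ∈ ℂⁿ : Σ_j |z_j|^{2 p_j} < 1}`. -/
def ellipsoid {n : ℕ} (p : Fin n → ℝ) : Set (Fin n → ℂ) :=
  {z | ∑ j, ‖z j‖ ^ (2 * p j) < 1}

/-- The Euclidean unit ball `𝔹_n ⊆ ℂⁿ`. -/
def euclideanBall (n : ℕ) : Set (Fin n → ℂ) :=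
  {z | ∑ j, ‖z j‖ ^ 2 < 1}

open scoped Topology

/-- Maximum principle: a holomorphic map sending the unit circle into an open convex set sends the
whole closed disc into it. -/
theorem mapsTo_closedBall_of_mapsTo_sphere {D : Set E} (hDo : IsOpen D) (hDc : Convex ℝ D)
    {H : ℂ → E} (hd : DiffContOnCl ℂ H (ball 0 1)) (hs : MapsTo H (sphere 0 1) D) :
    MapsTo H (closedBall 0 1) D := by
  intro z₀ hz₀
  by_contra hz
  obtain ⟨l, hl⟩ := RCLike.geometric_hahn_banach_open_point (𝕜 := ℂ) hDc hDo hz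
  have hg : DiffContOnCl ℂ (fun z => Complex.exp (l (H z))) (ball 0 1) :=
    (Complex.differentiable_exp.comp l.differentiable).comp_diffContOnCl hd
  obtain ⟨w, hw, hmax⟩ := Complex.exists_mem_frontier_isMaxOn_norm isBounded_ball
    (nonempty_ball.2 one_pos) hg
  rw [frontier_ball _ one_ne_zero] at hw
  rw [closure_ball _ one_ne_zero] at hmax
  have h1 : ‖Complex.exp (l (H z₀))‖ ≤ ‖Complex.exp (l (H w))‖ := hmax hz₀
  rw [Complex.norm_exp, Complex.norm_exp, Real.exp_le_exp] at h1
  exact absurd (hl _ (hs hw)) (not_lt.2 h1)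

/-- A holomorphic map vanishing at the points of a finite set is divisible by the corresponding
monic polynomial. -/
theorem exists_eq_prod_sub_smul [CompleteSpace E] {U : Set ℂ} (hU : IsOpen U) (s : Finset ℂ)
    (hs : ∀ a ∈ s, a ∈ U) {g : ℂ → E} (hg : DifferentiableOn ℂ g U) (h0 : ∀ a ∈ s, g a = 0) :
    ∃ k : ℂ → E, DifferentiableOn ℂ k U ∧ ∀ z, g z = (∏ a ∈ s, (z - a)) • k z := by
  induction s using Finset.induction_on with
  | empty => exact ⟨g, hg, by simp⟩
  | insert a s ha ih =>
    obtain ⟨k, hk, hgk⟩ := ih (fun b hb => hs b (Finset.mem_insert_of_mem hb))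
      (fun b hb => h0 b (Finset.mem_insert_of_mem hb))
    have hka : k a = 0 := by
      have h1 := hgk a
      rw [h0 a (Finset.mem_insert_self _ _)] at h1
      refine (smul_eq_zero.1 h1.symm).resolve_left (Finset.prod_ne_zero_iff.2 fun b hb => ?_)
      exact sub_ne_zero.2 (ne_of_mem_of_not_mem hb ha).symm
    refine ⟨dslope k a, (Complex.differentiableOn_dslope
      (hU.mem_nhds (hs a (Finset.mem_insert_self _ _)))).2 hk, fun z => ?_⟩
    rw [Finset.prod_insert ha, mul_comm, mul_smul, sub_smul_dslope, hka, sub_zero, hgk]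

theorem Convex.one_sub_smul_add_smul_add_mem {D : Set E} (hDc : Convex ℝ D) {x y v : E} {δ t : ℝ}
    (hx : x ∈ D) (hy : ball y δ ⊆ D) (ht0 : 0 < t) (ht1 : t ≤ 1) (hv : ‖v‖ < t * δ) :
    (1 - t) • x + t • y + v ∈ D := by
  have h1 : y + t⁻¹ • v ∈ D := by
    apply hy
    rw [mem_ball, dist_eq_norm, add_sub_cancel_left, norm_smul, norm_inv, Real.norm_eq_abs,
      abs_of_pos ht0, inv_mul_lt_iff₀ ht0]
    exact hv
  have h2 := hDc hx h1 (sub_nonneg.2 ht1) ht0.le (by ring)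
  rwa [smul_add, smul_inv_smul₀ ht0.ne', ← add_assoc] at h2

/-- The rational function `∏ⱼ (z - bⱼ)(r² - conj bⱼ z) / (r² - conj aⱼ z)`, whose quotient by
`∏ⱼ (z - aⱼ)` is positive on the circle of radius `r`. -/
def nodeFactor {m : ℕ} (a b : Fin m → ℂ) (r : ℝ) (z : ℂ) : ℂ :=
  ∏ j, (z - b j) * ((r : ℂ) ^ 2 - (starRingEnd ℂ) (b j) * z) /
    ((r : ℂ) ^ 2 - (starRingEnd ℂ) (a j) * z)

theorem nodeFactor_eq_of_norm_eq {m : ℕ} {a b : Fin m → ℂ} {r : ℝ} {z : ℂ} (hr : 0 < r)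
    (hz : ‖z‖ = r) (ha : ∀ j, ‖a j‖ < r) :
    nodeFactor a b r z =
      ((∏ j, ‖z - b j‖ ^ 2 / ‖z - a j‖ ^ 2 : ℝ) : ℂ) * ∏ j, (z - a j) := by
  have key : ∀ c : ℂ, (r : ℂ) ^ 2 - (starRingEnd ℂ) c * z = z * (starRingEnd ℂ) (z - c) := by
    intro c
    rw [map_sub, mul_sub, Complex.mul_conj, Complex.normSq_eq_norm_sq, hz]
    push_cast
    ring
  have hz0 : z ≠ 0 := norm_pos_iff.1 (hz ▸ hr)
  rw [nodeFactor, Complex.ofReal_prod, ← Finset.prod_mul_distrib]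
  refine Finset.prod_congr rfl fun j _ => ?_
  have hza : z - a j ≠ 0 := by
    rw [sub_ne_zero]
    rintro rfl
    exact (ha j).ne hz
  have hza' : (starRingEnd ℂ) (z - a j) ≠ 0 := (map_ne_zero _).2 hza
  rw [key, key]
  push_cast
  rw [← Complex.mul_conj', ← Complex.mul_conj']
  field_simp

theorem continuousAt_one_nodeFactor {m : ℕ} {a b : Fin m → ℂ} (ha : ∀ j, ‖a j‖ < 1)
    {w : ℂ} (hw : ‖w‖ < 1) : ContinuousAt (fun r : ℝ => nodeFactor a b r (r * w)) 1 := by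
  unfold nodeFactor
  refine tendsto_finsetProd _ fun j _ => ContinuousAt.div (by fun_prop) (by fun_prop) ?_
  rw [Complex.ofReal_one, one_pow, one_mul, sub_ne_zero]
  intro h
  have h1 : ‖(starRingEnd ℂ) (a j) * w‖ < 1 := by
    rw [norm_mul, RCLike.norm_conj]
    nlinarith [ha j, norm_nonneg (a j), norm_nonneg w]
  rw [← h, norm_one] at h1
  exact lt_irrefl _ h1

theorem differentiableAt_nodeFactor {m : ℕ} {a b : Fin m → ℂ} {r : ℝ} (hr : 0 < r)
    (ha : ∀ j, ‖a j‖ < r ^ 2) {w : ℂ} (hw : ‖w‖ < 1) :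
    DifferentiableAt ℂ (nodeFactor a b r) w := by
  unfold nodeFactor
  refine DifferentiableAt.fun_finsetProd fun j _ =>
    DifferentiableAt.fun_div (by fun_prop) (by fun_prop) ?_
  rw [sub_ne_zero]
  intro h
  have h1 : ‖(starRingEnd ℂ) (a j) * w‖ < r ^ 2 := by
    rw [norm_mul, RCLike.norm_conj]
    nlinarith [ha j, norm_nonneg (a j), norm_nonneg w]
  rw [← h, norm_pow, Complex.norm_real, Real.norm_of_nonneg hr.le] at h1
  exact lt_irrefl _ h1

theorem nodeFactor_self {m : ℕ} (a b : Fin m → ℂ) (r : ℝ) (i : Fin m) :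
    nodeFactor a b r (b i) = 0 :=
  Finset.prod_eq_zero (Finset.mem_univ i) (by simp)

/-- In an open convex set, weak extremality does not depend on the choice of the nodes. -/
theorem WeakExtremalFor.of_convex [CompleteSpace E] {D : Set E} (hDo : IsOpen D)
    (hDc : Convex ℝ D) {f : ℂ → E} (hf : DifferentiableOn ℂ f unitDisc)
    (hfD : MapsTo f unitDisc D) {m : ℕ} {a b : Fin m → ℂ} (ha : Function.Injective a)
    (had : ∀ j, a j ∈ unitDisc) (hb : Function.Injective b) (hbd : ∀ j, b j ∈ unitDisc)
    (hW : WeakExtremalFor D f b) : WeakExtremalFor D f a := by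
  rintro ⟨U, h, hUo, hU, hh, hhD, hha⟩
  apply hW
  have hanorm : ∀ j, ‖a j‖ < 1 := fun j => mem_ball_zero_iff.1 (had j)
  have hbnorm : ∀ j, ‖b j‖ < 1 := fun j => mem_ball_zero_iff.1 (hbd j)
  have hdisc : ∀ z : ℂ, ‖z‖ < 1 → z ∈ unitDisc := fun z hz => mem_ball_zero_iff.2 hz
  have hdiscU : unitDisc ⊆ U := ball_subset_closedBall.trans hU
  obtain ⟨k, hk, hfk⟩ := exists_eq_prod_sub_smul (E := E) (U := unitDisc) isOpen_ball
    (Finset.univ.image a) (by simpa using had) ((hh.mono hdiscU).sub hf)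
    (by simpa [sub_eq_zero] using hha)
  have hfk' : ∀ z, (∏ j, (z - a j)) • k z = h z - f z := fun z => by
    rw [← Pi.sub_apply, hfk, Finset.prod_image fun _ _ _ _ => (ha ·)]
  obtain ⟨δ, hδ, hKδ⟩ := ((isCompact_closedBall (0 : ℂ) 1).image_of_continuousOn
    (hh.continuousOn.mono hU)).exists_thickening_subset_open hDo
    (image_subset_iff.2 fun z hz => hhD (hU hz))
  have hball : ∀ z : ℂ, ‖z‖ ≤ 1 → ball (h z) δ ⊆ D := fun z hz =>
    (ball_subset_thickening (mem_image_of_mem h (mem_closedBall_zero_iff.2 hz)) δ).trans hKδ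
  obtain ⟨ρ, hρa, hρb, hρ0, hρ1⟩ : ∃ ρ : ℝ, (∀ j, ‖a j‖ < ρ) ∧ (∀ j, ‖b j‖ < ρ) ∧ 0 < ρ ∧
      ρ < 1 := by
    have h1 : ∀ᶠ ρ : ℝ in 𝓝[<] 1, (∀ j, ‖a j‖ < ρ) ∧ (∀ j, ‖b j‖ < ρ) ∧ 0 < ρ ∧ ρ < 1 :=
      (eventually_all.2 fun j => eventually_nhdsWithin_of_eventually_nhds
        (lt_mem_nhds (hanorm j))).and <| (eventually_all.2 fun j =>
        eventually_nhdsWithin_of_eventually_nhds (lt_mem_nhds (hbnorm j))).and <|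
        (eventually_nhdsWithin_of_eventually_nhds (lt_mem_nhds one_pos)).and
        self_mem_nhdsWithin
    exact h1.exists
  set σ : ℝ := (1 + ρ) / 2 with hσ
  set q : ℝ := ((1 - ρ) / 2) ^ 2 / 2 ^ 2 with hq
  have hq0 : 0 < q := by
    have : 0 < 1 - ρ := by linarith
    positivity
  set T : ℂ → ℝ := fun z => q ^ m * ∏ j, ‖z - b j‖ ^ 2 / ‖z - a j‖ ^ 2 with hT
  have hTbounds : ∀ z : ℂ, σ < ‖z‖ → ‖z‖ < 1 → q ^ m * q ^ m ≤ T z ∧ T z ≤ 1 := by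
    intro z hz hz1
    have hlo : ∀ c : ℂ, ‖c‖ < ρ → (1 - ρ) / 2 ≤ ‖z - c‖ := fun c hc => by
      have := norm_sub_norm_le z c
      linarith
    have hhi : ∀ c : ℂ, ‖c‖ < ρ → ‖z - c‖ ≤ 2 := fun c hc => by
      have := norm_sub_le z c
      linarith
    have hρ2 : 0 < (1 - ρ) / 2 := by linarith
    constructor
    · refine mul_le_mul_of_nonneg_left ?_ (by positivity)
      calc q ^ m = ∏ _j : Fin m, q := by simp
        _ ≤ _ := by
          refine Finset.prod_le_prod (fun _ _ => hq0.le) fun j _ => ?_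
          have h1 := hlo _ (hρa j)
          have h2 := hlo _ (hρb j)
          have h3 := hhi _ (hρa j)
          have h4 : 0 < ‖z - a j‖ := hρ2.trans_le h1
          rw [hq]
          gcongr
    · calc T z ≤ q ^ m * ∏ _j : Fin m, q⁻¹ := by
            refine mul_le_mul_of_nonneg_left ?_ (by positivity)
            refine Finset.prod_le_prod (fun _ _ => by positivity) fun j _ => ?_
            have h1 := hlo _ (hρa j)
            have h3 := hhi _ (hρb j)
            rw [hq, inv_div]
            gcongr
        _ = 1 := by
            rw [Finset.prod_const, Finset.card_univ, Fintype.card_fin, ← mul_pow,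
              mul_inv_cancel₀ hq0.ne', one_pow]
  set G : ℝ → ℂ → E := fun r z => f z + ((q : ℂ) ^ m * nodeFactor a b r z) • k z with hG
  have hGb : ∀ r i, G r (b i) = f (b i) := fun r i => by simp [hG, nodeFactor_self]
  have hGcirc : ∀ (r : ℝ) (z : ℂ), σ < r → r < 1 → ‖z‖ = r →
      G r z = (1 - T z) • f z + T z • h z := by
    intro r z hr hr1 hz
    have h1 : ((q : ℂ) ^ m * nodeFactor a b r z) • k z = T z • (h z - f z) := by
      rw [nodeFactor_eq_of_norm_eq (by linarith) hz (fun j => (hρa j).trans (by linarith)),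
        ← mul_assoc, mul_smul, hfk', ← Complex.coe_smul]
      simp [hT]
    rw [hG]
    simp only [h1]
    module
  set L : Fin m → ℂ → ℂ := fun i z => (Lagrange.basis Finset.univ b i).eval z with hL
  have hLdiff : ∀ i, Differentiable ℂ (L i) := fun i =>
    (Lagrange.basis Finset.univ b i).differentiable
  have hLb : ∀ i j, L i (b j) = if i = j then 1 else 0 := by
    intro i j
    split_ifs with hij
    · subst hij
      exact Lagrange.eval_basis_self hb.injOn (Finset.mem_univ i)
    · exact Lagrange.eval_basis_of_ne hij (Finset.mem_univ j)
  have hLbdd : ∀ i, ∃ C, ∀ z ∈ closedBall (0 : ℂ) 1, ‖L i z‖ ≤ C := fun i =>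
    (isCompact_closedBall (0 : ℂ) 1).exists_bound_of_continuousOn (hLdiff i).continuous.continuousOn
  choose C hC using hLbdd
  set S : ℝ → ℝ := fun r => ∑ i, C i * ‖f (b i) - G r (r * b i)‖ with hS
  have hScont : Tendsto S (𝓝 1) (𝓝 0) := by
    have h1 : ContinuousAt S 1 := by
      refine tendsto_finsetSum _ fun i _ => ?_
      have hmul : ContinuousAt (fun r : ℝ => (r : ℂ) * b i) 1 := by fun_prop
      have hcomp : ∀ {F : ℂ → E}, DifferentiableOn ℂ F unitDisc →
          ContinuousAt (fun r : ℝ => F (r * b i)) 1 := fun {F} hF => by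
        refine ContinuousAt.comp (g := F) ?_ hmul
        rw [Complex.ofReal_one, one_mul]
        exact (hF.differentiableAt (isOpen_ball.mem_nhds (hbd i))).continuousAt
      exact (continuousAt_const.mul (continuousAt_const.sub ((hcomp hf).add
        ((continuousAt_const.mul (continuousAt_one_nodeFactor hanorm (hbnorm i))).smul
          (hcomp hk)))).norm)
    have h2 : S 1 = 0 := by simp [hS, hGb]
    rw [← h2]
    exact h1
  obtain ⟨r, ⟨hrS, hrσ, hra⟩, hr1⟩ : ∃ r : ℝ, (S r < q ^ m * q ^ m * δ ∧ σ < r ∧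
      ∀ j, ‖a j‖ < r ^ 2) ∧ r < 1 := by
    have h1 : ∀ᶠ r : ℝ in 𝓝 1, S r < q ^ m * q ^ m * δ ∧ σ < r ∧ ∀ j, ‖a j‖ < r ^ 2 := by
      refine (hScont.eventually (gt_mem_nhds (by positivity))).and
        ((lt_mem_nhds (by linarith)).and (eventually_all.2 fun j => ?_))
      have h2 : Tendsto (fun r : ℝ => r ^ 2) (𝓝 1) (𝓝 (1 ^ 2)) := (continuous_pow 2).tendsto 1
      exact h2.eventually (lt_mem_nhds (by simpa using hanorm j))
    exact ((eventually_nhdsWithin_of_eventually_nhds h1).and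
      (self_mem_nhdsWithin (s := Iio (1 : ℝ)))).exists
  have hr0 : 0 < r := by linarith
  set H : ℂ → E := fun z => G r (r * z) + ∑ i, L i z • (f (b i) - G r (r * b i)) with hH
  have hV : ∀ z ∈ ball (0 : ℂ) r⁻¹, ‖(r : ℂ) * z‖ < 1 := fun z hz => by
    rw [mem_ball_zero_iff] at hz
    rw [norm_mul, Complex.norm_real, Real.norm_of_nonneg hr0.le]
    calc r * ‖z‖ < r * r⁻¹ := by gcongr
      _ = 1 := mul_inv_cancel₀ hr0.ne'
  have hclosed : closedBall (0 : ℂ) 1 ⊆ ball 0 r⁻¹ :=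
    closedBall_subset_ball ((one_lt_inv₀ hr0).2 hr1)
  have hHdiff : DifferentiableOn ℂ H (ball 0 r⁻¹) := by
    intro z hz
    refine DifferentiableAt.differentiableWithinAt ?_
    have hmul : DifferentiableAt ℂ (fun z : ℂ => (r : ℂ) * z) z := by fun_prop
    have hmem := isOpen_ball.mem_nhds (hdisc _ (hV z hz))
    refine DifferentiableAt.add ?_ (DifferentiableAt.fun_sum fun i _ =>
      (hLdiff i z).smul_const _)
    refine DifferentiableAt.comp (g := G r) z ?_ hmul
    exact (hf.differentiableAt hmem).add (((differentiableAt_nodeFactor hr0 hra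
      (hV z hz)).const_mul _).smul (hk.differentiableAt hmem))
  have hHs : MapsTo H (sphere 0 1) D := by
    intro z hz
    have hz1 : ‖z‖ = 1 := mem_sphere_zero_iff_norm.1 hz
    have hrz : ‖(r : ℂ) * z‖ = r := by
      rw [norm_mul, Complex.norm_real, Real.norm_of_nonneg hr0.le, hz1, mul_one]
    obtain ⟨hT0, hT1⟩ := hTbounds (r * z) (by rwa [hrz]) (by rwa [hrz])
    rw [hH]
    simp only
    rw [hGcirc r _ hrσ hr1 hrz]
    refine hDc.one_sub_smul_add_smul_add_mem (δ := δ) (hfD (hdisc _ (by rwa [hrz])))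
      (hball _ (by rw [hrz]; exact hr1.le)) (lt_of_lt_of_le (by positivity) hT0) hT1 ?_
    calc ‖∑ i, L i z • (f (b i) - G r (r * b i))‖ ≤ S r := by
          refine norm_sum_le_of_le _ fun i _ => ?_
          rw [norm_smul]
          gcongr
          exact hC i z (sphere_subset_closedBall hz)
      _ < q ^ m * q ^ m * δ := hrS
      _ ≤ _ := by gcongr
  have hHc : MapsTo H (closedBall 0 1) D := by
    refine mapsTo_closedBall_of_mapsTo_sphere hDo hDc ?_ hHs
    refine (hHdiff.mono ?_).diffContOnCl
    rwa [closure_ball _ one_ne_zero]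
  refine ⟨ball 0 r⁻¹ ∩ H ⁻¹' D, H, hHdiff.continuousOn.isOpen_inter_preimage isOpen_ball hDo,
    fun z hz => ⟨hclosed hz, hHc hz⟩, hHdiff.mono inter_subset_left, fun z hz => hz.2, fun j => ?_⟩
  simp [hH, hLb]

theorem isOpen_ellipsoid {n : ℕ} {p : Fin n → ℝ} (hp : ∀ j, 0 ≤ p j) : IsOpen (ellipsoid p) :=
  isOpen_lt (continuous_finsetSum _ fun j _ => (continuous_apply j).norm.rpow_const
    fun _ => Or.inr (by linarith [hp j])) continuous_const

theorem convex_ellipsoid {n : ℕ} {p : Fin n → ℝ} (hp : ∀ j, (1 : ℝ) / 2 ≤ p j) :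
    Convex ℝ (ellipsoid p) := by
  refine convex_iff_forall_pos.2 fun x hx y hy s t hs ht hst => ?_
  have hterm : ∀ j, ‖(s • x + t • y) j‖ ^ (2 * p j) ≤
      s * ‖x j‖ ^ (2 * p j) + t * ‖y j‖ ^ (2 * p j) := fun j => by
    have h1 : ‖(s • x + t • y) j‖ ≤ s * ‖x j‖ + t * ‖y j‖ := by
      refine (norm_add_le _ _).trans_eq ?_
      simp [abs_of_pos hs, abs_of_pos ht]
    refine (Real.rpow_le_rpow (norm_nonneg _) h1 (by linarith [hp j])).trans ?_
    exact (convexOn_rpow (by linarith [hp j])).2 (norm_nonneg (x j)) (norm_nonneg (y j))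
      hs.le ht.le hst
  refine (Finset.sum_le_sum fun j _ => hterm j).trans_lt ?_
  rw [Finset.sum_add_distrib, ← Finset.mul_sum, ← Finset.mul_sum]
  have hx' : ∑ j, ‖x j‖ ^ (2 * p j) < 1 := hx
  have hy' : ∑ j, ‖y j‖ ^ (2 * p j) < 1 := hy
  nlinarith

theorem exists_injective_mem_unitDisc (m : ℕ) :
    ∃ lam : Fin m → ℂ, Function.Injective lam ∧ ∀ j, lam j ∈ unitDisc := by
  have hinf : (unitDisc : Set ℂ).Infinite :=
    infinite_of_mem_nhds (0 : ℂ) (ball_mem_nhds 0 one_pos)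
  have e := hinf.natEmbedding
  exact ⟨fun i => e i, fun i j hij => Fin.ext (e.injective (Subtype.ext hij)), fun i => (e i).2⟩

/-- For `p ∈ S_n` (there exist reals `b₁, …, b_n` with
`1 ≤ b_i ≤ b_n` for `i = 1, …, n-1` such that every `p_j` belongs to
`{b₁, …, b_{n-1}, b_n/2}`), weak `m`-extremality and `m`-extremality coincide in
the complex ellipsoid `E(p)`. -/
theorem weak_extremal_iff_extremal_in_Sn_ellipsoid
    (n : ℕ) (hn : 1 ≤ n) (p : Fin n → ℝ) (hp : ∀ j, (1 : ℝ) / 2 ≤ p j)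
    (hpS : ∃ b : Fin n → ℝ,
      (∀ i : Fin n, (i : ℕ) < n - 1 → 1 ≤ b i ∧ b i ≤ b ⟨n - 1, by omega⟩) ∧
      (∀ j, (∃ i : Fin n, (i : ℕ) < n - 1 ∧ p j = b i) ∨ p j = b ⟨n - 1, by omega⟩ / 2))
    (m : ℕ) (hm : 2 ≤ m)
    (f : ℂ → Fin n → ℂ) (hf : DifferentiableOn ℂ f unitDisc)
    (hfD : Set.MapsTo f unitDisc (ellipsoid p)) :
    IsWeakExtremal (ellipsoid p) f m ↔ IsExtremal (ellipsoid p) f m := by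
  constructor
  · rintro ⟨a, ha, had, hW⟩ b hb hbd
    exact hW.of_convex (isOpen_ellipsoid fun j => by linarith [hp j]) (convex_ellipsoid hp) hf hfD
      hb hbd ha had
  · intro hE
    obtain ⟨a, ha, had⟩ := exists_injective_mem_unitDisc m
    exact ⟨a, ha, had, hE a ha had⟩
end
end

section
/- Let D ⊆ ℂ be a domain which is not simply connected and admits a holomorphic covering map Π : 𝔻 → D. Then a holomorphic function f : 𝔻 → D is a weak m-extremal of D if and only if f = Π∘B for some non-constant Blaschke product B of degree at most m−1; moreover, no such f is an m-extremal of D. -/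
open Complex Metric Set Filter

noncomputable section

variable {E : Type*} [NormedAddCommGroup E] [NormedSpace ℂ E]

lemma normSq_one_sub_conj_mul_sub (a z : ℂ) :
    ‖1 - (starRingEnd ℂ) a * z‖ ^ 2 - ‖z - a‖ ^ 2 = (1 - ‖a‖ ^ 2) * (1 - ‖z‖ ^ 2) := by
  simp only [← Complex.normSq_eq_norm_sq, Complex.normSq_apply, Complex.sub_re, Complex.sub_im,
    Complex.mul_re, Complex.mul_im, Complex.conj_re, Complex.conj_im, Complex.one_re,
    Complex.one_im]
  ring

lemma one_sub_conj_mul_ne_zero {a z : ℂ} (ha : ‖a‖ < 1) (hz : ‖z‖ ≤ 1) :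
    1 - (starRingEnd ℂ) a * z ≠ 0 := by
  intro h
  have h1 : (starRingEnd ℂ) a * z = 1 := (sub_eq_zero.mp h).symm
  have h2 : ‖a‖ * ‖z‖ = 1 := by
    simpa [Complex.norm_conj] using congrArg norm h1
  nlinarith [norm_nonneg a, norm_nonneg z]

lemma norm_mobius_lt_one {a z : ℂ} (ha : ‖a‖ < 1) (hz : ‖z‖ < 1) : ‖mobius a z‖ < 1 := by
  have h := normSq_one_sub_conj_mul_sub a z
  have hd := norm_pos_iff.mpr (one_sub_conj_mul_ne_zero ha hz.le)
  rw [mobius, norm_div, div_lt_one hd]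
  have h1 : 0 < (1 - ‖a‖ ^ 2) * (1 - ‖z‖ ^ 2) :=
    mul_pos (by nlinarith [norm_nonneg a]) (by nlinarith [norm_nonneg z])
  exact lt_of_pow_lt_pow_left₀ 2 hd.le (by linarith)

lemma norm_mobius_eq_one {a z : ℂ} (ha : ‖a‖ < 1) (hz : ‖z‖ = 1) : ‖mobius a z‖ = 1 := by
  have h := normSq_one_sub_conj_mul_sub a z
  have hd := norm_pos_iff.mpr (one_sub_conj_mul_ne_zero ha hz.le)
  rw [mobius, norm_div, div_eq_one_iff_eq hd.ne']
  rw [hz] at h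
  exact (pow_left_inj₀ (norm_nonneg _) hd.le two_ne_zero).mp (by linarith)

lemma norm_mobius_le_one {a z : ℂ} (ha : ‖a‖ < 1) (hz : ‖z‖ ≤ 1) : ‖mobius a z‖ ≤ 1 :=
  hz.lt_or_eq.elim (fun h => (norm_mobius_lt_one ha h).le) fun h => (norm_mobius_eq_one ha h).le

@[simp] lemma mobius_self (a : ℂ) : mobius a a = 0 := by simp [mobius]

@[simp] lemma mobius_neg_zero (a : ℂ) : mobius (-a) 0 = a := by simp [mobius]

@[simp] lemma mobius_zero_left (z : ℂ) : mobius 0 z = z := by simp [mobius]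

lemma mobius_neg_mobius {a z : ℂ} (ha : ‖a‖ < 1) (hz : ‖z‖ ≤ 1) :
    mobius (-a) (mobius a z) = z := by
  have h1 := one_sub_conj_mul_ne_zero ha hz
  have h2 := one_sub_conj_mul_ne_zero ha ha.le
  have e1 : mobius a z + a = z * (1 - (starRingEnd ℂ) a * a) / (1 - (starRingEnd ℂ) a * z) := by
    rw [mobius, eq_div_iff h1, add_mul, div_mul_cancel₀ _ h1]; ring
  have e2 : 1 + (starRingEnd ℂ) a * mobius a z =
      (1 - (starRingEnd ℂ) a * a) / (1 - (starRingEnd ℂ) a * z) := by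
    rw [mobius, eq_div_iff h1, add_mul, mul_assoc, div_mul_cancel₀ _ h1]; ring
  rw [mobius, map_neg, sub_neg_eq_add, neg_mul, sub_neg_eq_add, e1, e2,
    div_div_div_cancel_right₀ h1, mul_div_cancel_right₀ _ h2]

lemma mobius_injOn {a : ℂ} (ha : ‖a‖ < 1) : InjOn (mobius a) (closedBall 0 1) := by
  intro z hz w hw h
  rw [mem_closedBall_zero_iff] at hz hw
  rw [← mobius_neg_mobius ha hz, h, mobius_neg_mobius ha hw]

lemma analyticAt_mobius {a z : ℂ} (ha : ‖a‖ < 1) (hz : ‖z‖ ≤ 1) : AnalyticAt ℂ (mobius a) z := by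
  unfold mobius
  exact (by fun_prop : AnalyticAt ℂ (fun z => z - a) z).div (by fun_prop)
    (one_sub_conj_mul_ne_zero ha hz)

lemma mem_unitDisc {z : ℂ} : z ∈ unitDisc ↔ ‖z‖ < 1 := mem_ball_zero_iff

lemma isOpen_unitDisc : IsOpen unitDisc := isOpen_ball

lemma unitDisc_subset_closedBall : unitDisc ⊆ closedBall 0 1 := ball_subset_closedBall

lemma differentiableOn_mobius {a : ℂ} (ha : ‖a‖ < 1) : DifferentiableOn ℂ (mobius a) unitDisc :=
  fun _ hz => (analyticAt_mobius ha (mem_unitDisc.mp hz).le).differentiableAt.differentiableWithinAt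

lemma mapsTo_mobius {a : ℂ} (ha : ‖a‖ < 1) : MapsTo (mobius a) unitDisc unitDisc :=
  fun _ hz => mem_unitDisc.mpr (norm_mobius_lt_one ha (mem_unitDisc.mp hz))

lemma IsBlaschkeOn.congr {B C : ℂ → ℂ} {k : ℕ} (hB : IsBlaschkeOn B k)
    (h : ∀ z ∈ unitDisc, C z = B z) : IsBlaschkeOn C k := by
  obtain ⟨ζ, α, h1, h2, h3⟩ := hB
  exact ⟨ζ, α, h1, h2, fun z hz => (h z hz).trans (h3 z hz)⟩

lemma IsBlaschkeOn.of_mul_mobius {B G : ℂ → ℂ} {k : ℕ} {w : ℂ} (hw : ‖w‖ < 1)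
    (hG : IsBlaschkeOn G k) (h : ∀ z ∈ unitDisc, B z = mobius w z * G z) :
    IsBlaschkeOn B (k + 1) := by
  obtain ⟨ζ, α, h1, h2, h3⟩ := hG
  refine ⟨ζ, Fin.cons w α, h1, Fin.cases hw h2, fun z hz => ?_⟩
  rw [h z hz, h3 z hz, Fin.prod_univ_succ]
  simp only [Fin.cons_zero, Fin.cons_succ]
  ring

lemma Polynomial.exists_eq_C_mul_prod_X_sub_C {N : Polynomial ℂ} {k : ℕ} (hk : N.natDegree = k) :
    ∃ β : Fin k → ℂ, N = Polynomial.C N.leadingCoeff *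
      ∏ j, (Polynomial.X - Polynomial.C (β j)) := by
  subst hk
  have hs := IsAlgClosed.splits N
  have hcard : N.roots.toList.length = N.natDegree := by
    rw [Multiset.length_toList]; exact hs.natDegree_eq_card_roots.symm
  refine ⟨fun j => N.roots.toList.get (j.cast hcard.symm), ?_⟩
  have h : ∏ j : Fin N.natDegree,
      (Polynomial.X - Polynomial.C (N.roots.toList.get (j.cast hcard.symm))) =
      (N.roots.map fun a => Polynomial.X - Polynomial.C a).prod := by
    conv_rhs => rw [← N.roots.coe_toList]
    rw [Multiset.map_coe, Multiset.prod_coe, ← Fin.prod_univ_fun_getElem]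
    exact Fintype.prod_equiv (finCongr hcard.symm) _ _ fun _ => rfl
  rw [h]
  exact hs.eq_prod_roots

lemma norm_one_sub_conj_mul_le {a z : ℂ} (ha : ‖a‖ < 1) (hz : 1 ≤ ‖z‖) :
    ‖1 - (starRingEnd ℂ) a * z‖ ≤ ‖z - a‖ := by
  have h := normSq_one_sub_conj_mul_sub a z
  have h1 : (1 - ‖a‖ ^ 2) * (1 - ‖z‖ ^ 2) ≤ 0 :=
    mul_nonpos_of_nonneg_of_nonpos (by nlinarith [norm_nonneg a]) (by nlinarith)
  exact le_of_pow_le_pow_left₀ two_ne_zero (norm_nonneg _) (by linarith)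

lemma IsBlaschkeOn.mobius_comp {B : ℂ → ℂ} {k : ℕ} {a : ℂ} (ha : ‖a‖ < 1)
    (hB : IsBlaschkeOn B k) : IsBlaschkeOn (fun z => mobius a (B z)) k := by
  obtain ⟨ζ, α, hζ, hα, hB⟩ := hB
  have hζ0 : ζ ≠ 0 := fun h => by simp [h] at hζ
  have hζc : (starRingEnd ℂ) ζ * ζ = 1 := by
    rw [mul_comm, Complex.mul_conj, Complex.normSq_eq_norm_sq, hζ]; norm_num
  set P : ℂ → ℂ := fun z => ∏ j, (z - α j) with hP
  set Q : ℂ → ℂ := fun z => ∏ j, (1 - (starRingEnd ℂ) (α j) * z) with hQ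
  set N : Polynomial ℂ := Polynomial.C ζ * ∏ j, (Polynomial.X - Polynomial.C (α j)) -
    Polynomial.C a * ∏ j, (Polynomial.C (-(starRingEnd ℂ) (α j)) * Polynomial.X + Polynomial.C 1)
    with hN
  have hNeval : ∀ z, N.eval z = ζ * P z - a * Q z := by
    intro z
    simp only [hN, hP, hQ, Polynomial.eval_sub, Polynomial.eval_mul, Polynomial.eval_C,
      Polynomial.eval_prod, Polynomial.eval_X, Polynomial.eval_add]
    congr 2
    exact Finset.prod_congr rfl fun j _ => by ring
  have hcoeff : N.coeff k ≠ 0 := by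
    have h1 := Polynomial.coeff_prod_of_natDegree_le (s := Finset.univ)
      (fun j => Polynomial.X - Polynomial.C (α j)) 1
      (fun j _ => Polynomial.natDegree_X_sub_C_le (α j))
    have h2 := Polynomial.coeff_prod_of_natDegree_le (s := Finset.univ)
      (fun j => Polynomial.C (-(starRingEnd ℂ) (α j)) * Polynomial.X + Polynomial.C 1) 1
      (fun j _ => Polynomial.natDegree_linear_le)
    simp only [Finset.card_univ, Fintype.card_fin, mul_one] at h1 h2
    rw [hN, Polynomial.coeff_sub, Polynomial.coeff_C_mul, Polynomial.coeff_C_mul, h1, h2]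
    simp only [Polynomial.coeff_sub, Polynomial.coeff_X_one, Polynomial.coeff_C_succ, sub_zero,
      Finset.prod_const_one, mul_one, Polynomial.coeff_add, Polynomial.coeff_C_mul, add_zero]
    intro h
    have h3 : ‖a‖ * ∏ j, ‖α j‖ = 1 := by
      rw [← hζ, sub_eq_zero.mp h]
      simp [norm_prod]
    have h4 : ∏ j, ‖α j‖ ≤ 1 :=
      Finset.prod_le_one (fun _ _ => norm_nonneg _) fun j _ => (hα j).le
    nlinarith [norm_nonneg a]
  have hdeg : N.natDegree = k := by
    refine Polynomial.natDegree_eq_of_le_of_coeff_ne_zero ?_ hcoeff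
    have hle : ∀ p : Fin k → Polynomial ℂ, (∀ j, (p j).natDegree ≤ 1) →
        (∏ j, p j).natDegree ≤ k := fun p hp =>
      (Polynomial.natDegree_prod_le _ _).trans
        ((Finset.sum_le_sum fun j _ => hp j).trans (by simp))
    refine (Polynomial.natDegree_sub_le _ _).trans (max_le ?_ ?_)
    · exact (Polynomial.natDegree_C_mul_le _ _).trans
        (hle _ fun j => Polynomial.natDegree_X_sub_C_le _)
    · exact (Polynomial.natDegree_C_mul_le _ _).trans
        (hle _ fun j => Polynomial.natDegree_linear_le)
  obtain ⟨β, hβ⟩ := Polynomial.exists_eq_C_mul_prod_X_sub_C hdeg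
  set c := N.leadingCoeff with hc
  have hc0 : c ≠ 0 := by
    rw [hc, Polynomial.leadingCoeff, hdeg]; exact hcoeff
  have hfac : ∀ z, ζ * P z - a * Q z = c * ∏ j, (z - β j) := by
    intro z
    rw [← hNeval, hβ]
    simp [Polynomial.eval_prod]
  have hβ1 : ∀ j, ‖β j‖ < 1 := by
    intro j
    by_contra! hj
    have h0 : ζ * P (β j) = a * Q (β j) := by
      rw [← sub_eq_zero, hfac, Finset.prod_eq_zero (Finset.mem_univ j) (sub_self _), mul_zero]
    have hPpos : 0 < ‖P (β j)‖ := by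
      rw [norm_pos_iff, hP]
      refine Finset.prod_ne_zero_iff.mpr fun i _ h => ?_
      rw [sub_eq_zero.mp h] at hj
      exact absurd (hα i) (not_lt.mpr hj)
    have hQP : ‖Q (β j)‖ ≤ ‖P (β j)‖ := by
      simp only [hP, hQ, norm_prod]
      exact Finset.prod_le_prod (fun _ _ => norm_nonneg _)
        fun i _ => norm_one_sub_conj_mul_le (hα i) hj
    have h1 : ‖P (β j)‖ = ‖a‖ * ‖Q (β j)‖ := by
      simpa [hζ] using congrArg norm h0
    nlinarith [norm_nonneg a]
  have hden : ∀ z, Q z - (starRingEnd ℂ) a * (ζ * P z) =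
      ζ * (starRingEnd ℂ) c * ∏ j, (1 - (starRingEnd ℂ) (β j) * z) := by
    have hne : ∀ z : ℂ, z ≠ 0 → Q z - (starRingEnd ℂ) a * (ζ * P z) =
        ζ * (starRingEnd ℂ) c * ∏ j, (1 - (starRingEnd ℂ) (β j) * z) := by
      intro z hz
      have h := congrArg (starRingEnd ℂ) (hfac ((starRingEnd ℂ) z)⁻¹)
      simp only [hP, hQ, map_sub, map_mul, map_prod, map_inv₀, Complex.conj_conj, map_one] at h
      have e : ∀ γ : Fin k → ℂ, z ^ k * ∏ j, (z⁻¹ - (starRingEnd ℂ) (γ j)) =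
          ∏ j, (1 - (starRingEnd ℂ) (γ j) * z) := by
        intro γ
        have : z ^ k = ∏ _j : Fin k, z := by simp
        rw [this, ← Finset.prod_mul_distrib]
        exact Finset.prod_congr rfl fun j _ => by field_simp
      have e' : z ^ k * ∏ j, (1 - α j * z⁻¹) = ∏ j, (z - α j) := by
        have : z ^ k = ∏ _j : Fin k, z := by simp
        rw [this, ← Finset.prod_mul_distrib]
        exact Finset.prod_congr rfl fun j _ => by field_simp
      rw [← e β, hP, hQ]
      simp only
      rw [← e α, ← e']
      linear_combination (ζ * z ^ k) * h -
        (z ^ k * ∏ j, (z⁻¹ - (starRingEnd ℂ) (α j))) * hζc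
    have hcont : Continuous fun z => Q z - (starRingEnd ℂ) a * (ζ * P z) := by fun_prop
    have hcont' : Continuous fun z : ℂ =>
      ζ * (starRingEnd ℂ) c * ∏ j, (1 - (starRingEnd ℂ) (β j) * z) := by fun_prop
    exact congrFun (hcont.ext_on (dense_compl_singleton (0 : ℂ)) hcont' fun z hz => hne z hz)
  refine ⟨c / (ζ * (starRingEnd ℂ) c), β, ?_, hβ1, fun z hz => ?_⟩
  · simp [hζ, hc0]
  · have hz' := (mem_unitDisc.mp hz).le
    have hQ0 : Q z ≠ 0 := Finset.prod_ne_zero_iff.mpr fun j _ =>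
      one_sub_conj_mul_ne_zero (hα j) hz'
    have hBz : B z = ζ * P z / Q z := by
      rw [hB z hz]
      simp only [mobius, Finset.prod_div_distrib]
      rw [mul_div_assoc]
    have h1 : mobius a (B z) = (ζ * P z - a * Q z) / (Q z - (starRingEnd ℂ) a * (ζ * P z)) := by
      rw [mobius, hBz, ← mul_div_mul_right _ _ hQ0]
      congr 1
      · field_simp
      · field_simp
    simp only [h1, hfac, hden]
    simp only [mobius, Finset.prod_div_distrib]
    rw [mul_div_mul_comm]

lemma IsBlaschkeOn.exists_eq {B : ℂ → ℂ} {k : ℕ} (hk : 1 ≤ k) (hB : IsBlaschkeOn B k)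
    (hmaps : MapsTo B unitDisc unitDisc) {w : ℂ} (hw : ‖w‖ < 1) : ∃ z ∈ unitDisc, B z = w := by
  obtain ⟨ζ, α, h1, h2, h3⟩ := hB.mobius_comp hw
  have hα : α ⟨0, hk⟩ ∈ unitDisc := mem_unitDisc.mpr (h2 _)
  refine ⟨α ⟨0, hk⟩, hα, mobius_injOn hw (unitDisc_subset_closedBall (hmaps hα))
    (by simpa using hw.le) ?_⟩
  rw [mobius_self]
  refine (h3 _ hα).trans ?_
  rw [Finset.prod_eq_zero (Finset.mem_univ (⟨0, hk⟩ : Fin k)) (mobius_self _), mul_zero]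

lemma IsBlaschkeOn.differentiableOn {B : ℂ → ℂ} {k : ℕ} (hB : IsBlaschkeOn B k) :
    DifferentiableOn ℂ B unitDisc := by
  obtain ⟨ζ, α, -, h2, h3⟩ := hB
  refine DifferentiableOn.congr ?_ h3
  exact (DifferentiableOn.fun_finsetProd fun j _ => differentiableOn_mobius (h2 j)).const_mul ζ

lemma IsBlaschkeOn.mapsTo {B : ℂ → ℂ} {k : ℕ} (hk : 1 ≤ k) (hB : IsBlaschkeOn B k) :
    MapsTo B unitDisc unitDisc := by
  obtain ⟨ζ, α, h1, h2, h3⟩ := hB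
  intro z hz
  obtain ⟨k, rfl⟩ := Nat.exists_eq_succ_of_ne_zero (Nat.one_le_iff_ne_zero.mp hk)
  rw [mem_unitDisc, h3 z hz, norm_mul, h1, one_mul, norm_prod, Fin.prod_univ_succ]
  have hz := mem_unitDisc.mp hz
  exact mul_lt_one_of_nonneg_of_lt_one_left (norm_nonneg _) (norm_mobius_lt_one (h2 _) hz)
    (Finset.prod_le_one (fun _ _ => norm_nonneg _) fun j _ => (norm_mobius_lt_one (h2 _) hz).le)

lemma IsBlaschkeOn.exists_factor {B : ℂ → ℂ} {k : ℕ} {w : ℂ} (hB : IsBlaschkeOn B (k + 1))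
    (hw : w ∈ unitDisc) (h0 : B w = 0) :
    ∃ G, IsBlaschkeOn G k ∧ ∀ z ∈ unitDisc, B z = mobius w z * G z := by
  obtain ⟨ζ, α, h1, h2, h3⟩ := hB
  have hζ0 : ζ ≠ 0 := fun h => by simp [h] at h1
  have h := h3 w hw
  rw [h0, eq_comm, mul_eq_zero, or_iff_right hζ0, Finset.prod_eq_zero_iff] at h
  obtain ⟨i, -, hi⟩ := h
  have hwi : w = α i := mobius_injOn (h2 i) (unitDisc_subset_closedBall hw)
    (by simpa using (h2 i).le) (by rw [hi, mobius_self])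
  refine ⟨fun z => ζ * ∏ j, mobius (α (i.succAbove j)) z,
    ⟨ζ, _, h1, fun j => h2 _, fun z _ => rfl⟩, fun z hz => ?_⟩
  rw [h3 z hz, Fin.prod_univ_succAbove _ i, hwi]
  ring

/-- The **Schwarz–Pick lemma** for self-maps of the unit disc. -/
lemma norm_mobius_le_of_mapsTo {F : ℂ → ℂ} (hF : DifferentiableOn ℂ F unitDisc)
    (hmaps : MapsTo F unitDisc unitDisc) {w z : ℂ} (hw : w ∈ unitDisc) (hz : z ∈ unitDisc) :
    ‖mobius (F w) (F z)‖ ≤ ‖mobius w z‖ := by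
  have hw' := mem_unitDisc.mp hw
  have hz' := mem_unitDisc.mp hz
  have hFw := mem_unitDisc.mp (hmaps hw)
  have hnw : ‖-w‖ < 1 := by rwa [norm_neg]
  have h := Complex.norm_le_norm_of_mapsTo_ball
    (f := fun u => mobius (F w) (F (mobius (-w) u))) (R := 1) (z := mobius w z)
    ((differentiableOn_mobius hFw).comp (hF.comp (differentiableOn_mobius hnw) (mapsTo_mobius hnw))
      (hmaps.comp (mapsTo_mobius hnw)))
    (fun u hu => ball_subset_closedBall (mapsTo_mobius hFw (hmaps (mapsTo_mobius hnw hu))))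
    (by simp) (norm_mobius_lt_one hw' hz')
  simpa only [mobius_neg_mobius hw' hz'.le] using h

lemma mul_dslope_eq {F : ℂ → ℂ} {w z : ℂ} (h0 : F w = 0) (hw : ‖w‖ < 1) (hz : ‖z‖ ≤ 1) :
    F z = mobius w z * (dslope F w z * (1 - (starRingEnd ℂ) w * z)) := by
  have h := sub_smul_dslope F w z
  rw [h0, sub_zero, smul_eq_mul] at h
  rw [← h, mobius, mul_comm (dslope F w z), ← mul_assoc,
    div_mul_cancel₀ _ (one_sub_conj_mul_ne_zero hw hz)]

/-- Division of a self-map of the disc by a Möbius factor at one of its zeros. -/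
lemma exists_eq_mobius_mul {F : ℂ → ℂ} (hF : DifferentiableOn ℂ F unitDisc)
    (hmaps : MapsTo F unitDisc unitDisc) {w : ℂ} (hw : w ∈ unitDisc) (h0 : F w = 0) :
    ∃ G : ℂ → ℂ, DifferentiableOn ℂ G unitDisc ∧ (∀ z ∈ unitDisc, ‖G z‖ ≤ 1) ∧
      ∀ z ∈ unitDisc, F z = mobius w z * G z := by
  have hw' := mem_unitDisc.mp hw
  set G : ℂ → ℂ := fun z => dslope F w z * (1 - (starRingEnd ℂ) w * z) with hG
  have hmul : ∀ z ∈ unitDisc, F z = mobius w z * G z := fun z hz =>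
    mul_dslope_eq h0 hw' (mem_unitDisc.mp hz).le
  have hGd : DifferentiableOn ℂ G unitDisc :=
    ((differentiableOn_dslope (isOpen_unitDisc.mem_nhds hw)).mpr hF).mul (by fun_prop)
  have hne : ∀ z ∈ unitDisc, z ≠ w → ‖G z‖ ≤ 1 := by
    intro z hz hzw
    have h := norm_mobius_le_of_mapsTo hF hmaps hw hz
    rw [h0, mobius_zero_left, hmul z hz, norm_mul] at h
    have hpos : 0 < ‖mobius w z‖ := by
      rw [norm_pos_iff]
      intro h
      exact hzw (mobius_injOn hw' (unitDisc_subset_closedBall hz) (unitDisc_subset_closedBall hw)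
        (by rw [h, mobius_self]))
    exact le_of_mul_le_mul_left (by simpa using h) hpos
  refine ⟨G, hGd, fun z hz => ?_, hmul⟩
  rcases eq_or_ne z w with rfl | hzw
  · have hc : ContinuousAt G z := (hGd.differentiableAt (isOpen_unitDisc.mem_nhds hz)).continuousAt
    refine le_of_tendsto (hc.norm.tendsto.mono_left (nhdsWithin_le_nhds (s := {z}ᶜ))) ?_
    filter_upwards [self_mem_nhdsWithin,
      mem_nhdsWithin_of_mem_nhds (isOpen_unitDisc.mem_nhds hz)] with y hy hyd
    exact hne y hyd hy
  · exact hne z hz hzw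

/-- `h` is holomorphic near the closed unit disc and maps the closed disc to the open one. -/
def IsStrictSelfMap (h : ℂ → ℂ) : Prop :=
  AnalyticOnNhd ℂ h (closedBall 0 1) ∧ ∀ z, ‖z‖ ≤ 1 → ‖h z‖ < 1

lemma isStrictSelfMap_const {c : ℂ} (hc : ‖c‖ < 1) : IsStrictSelfMap fun _ => c :=
  ⟨fun _ _ => analyticAt_const, fun _ _ => hc⟩

lemma IsStrictSelfMap.mobius_comp {h : ℂ → ℂ} (hh : IsStrictSelfMap h) {a : ℂ} (ha : ‖a‖ < 1) :
    IsStrictSelfMap fun z => mobius a (h z) := by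
  refine ⟨fun z hz => ?_, fun z hz => norm_mobius_lt_one ha (hh.2 z hz)⟩
  exact (analyticAt_mobius ha (hh.2 z (by simpa using hz)).le).comp (hh.1 z hz)

lemma IsStrictSelfMap.mobius_mul {h : ℂ → ℂ} (hh : IsStrictSelfMap h) {a : ℂ} (ha : ‖a‖ < 1) :
    IsStrictSelfMap fun z => mobius a z * h z := by
  refine ⟨fun z hz => (analyticAt_mobius ha (by simpa using hz)).mul (hh.1 z hz), fun z hz => ?_⟩
  rw [norm_mul]
  exact mul_lt_one_of_nonneg_of_lt_one_right (norm_mobius_le_one ha hz) (norm_nonneg _) (hh.2 z hz)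

lemma IsStrictSelfMap.exists_eq_mobius_mul {F : ℂ → ℂ} (hF : IsStrictSelfMap F) {w : ℂ}
    (hw : ‖w‖ < 1) (h0 : F w = 0) :
    ∃ G, IsStrictSelfMap G ∧ ∀ z, ‖z‖ ≤ 1 → F z = mobius w z * G z := by
  set G : ℂ → ℂ := fun z => dslope F w z * (1 - (starRingEnd ℂ) w * z) with hG
  have hmul : ∀ z, ‖z‖ ≤ 1 → F z = mobius w z * G z := fun z hz => mul_dslope_eq h0 hw hz
  have hS : IsOpen {z | AnalyticAt ℂ F z} := isOpen_analyticAt ℂ F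
  have hGa : AnalyticOnNhd ℂ G (closedBall 0 1) := by
    intro z hz
    have hd : DifferentiableOn ℂ (dslope F w) {z | AnalyticAt ℂ F z} :=
      (differentiableOn_dslope (hS.mem_nhds (hF.1 w (by simpa using hw.le)))).mpr
        fun z hz => AnalyticAt.differentiableWithinAt hz
    exact (hd.analyticAt (hS.mem_nhds (hF.1 z hz))).mul (by fun_prop)
  refine ⟨G, ⟨hGa, fun z hz => ?_⟩, hmul⟩
  have hdc : DiffContOnCl ℂ G (ball 0 1) :=
    (hGa.differentiableOn.mono closure_ball_subset_closedBall).diffContOnCl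
  obtain ⟨p, hp, hmax⟩ :=
    Complex.exists_mem_frontier_isMaxOn_norm isBounded_ball ⟨0, mem_ball_self one_pos⟩ hdc
  rw [frontier_ball _ one_ne_zero, mem_sphere_zero_iff_norm] at hp
  rw [closure_ball _ one_ne_zero] at hmax
  have h1 : ‖G p‖ < 1 := by
    have := hF.2 p hp.le
    rwa [hmul p hp.le, norm_mul, norm_mobius_eq_one hw hp, one_mul] at this
  exact (hmax (by simpa using hz : z ∈ closedBall (0 : ℂ) 1)).trans_lt h1

/-- A Blaschke product of degree `k` cannot agree at `k + 1` points with a map that sends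
the closed disc holomorphically to the open disc. -/
lemma IsBlaschkeOn.not_interpolated {k : ℕ} : ∀ {B h : ℂ → ℂ} {lam : Fin (k + 1) → ℂ},
    IsBlaschkeOn B k → IsStrictSelfMap h → Function.Injective lam → (∀ j, lam j ∈ unitDisc) →
    ¬ ∀ j, h (lam j) = B (lam j) := by
  induction k with
  | zero =>
    intro B h lam ⟨ζ, α, hζ, _, hB⟩ hh _ hlam heq
    have h1 := hh.2 (lam 0) (mem_unitDisc.mp (hlam 0)).le
    rw [heq, hB _ (hlam 0)] at h1
    simp [hζ] at h1
  | succ k ih =>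
    intro B h lam hB hh hinj hlam heq
    have h0 := mem_unitDisc.mp (hlam 0)
    have hb := hh.2 (lam 0) h0.le
    obtain ⟨G, hG, hBG⟩ := (hB.mobius_comp hb).exists_factor (hlam 0)
      (by rw [heq 0, mobius_self])
    obtain ⟨H, hH, hhH⟩ := (hh.mobius_comp hb).exists_eq_mobius_mul h0 (mobius_self _)
    refine ih hG hH (hinj.comp (Fin.succ_injective _)) (fun j => hlam j.succ) fun j => ?_
    have e := hBG _ (hlam j.succ)
    simp only [← heq j.succ, hhH _ (mem_unitDisc.mp (hlam j.succ)).le] at e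
    refine mul_left_cancel₀ ?_ e
    intro h
    exact Fin.succ_ne_zero j (hinj (mobius_injOn h0 (unitDisc_subset_closedBall (hlam _))
      (unitDisc_subset_closedBall (hlam 0)) (by rw [h, mobius_self])))

/-- Solution of the extremal Nevanlinna–Pick problem on the disc: a self-map whose values at `m`
points are not interpolated by a map sending the closed disc into the open disc is a
non-constant Blaschke product of degree at most `m - 1`. -/
lemma exists_isBlaschkeOn_of_not_interpolated {m : ℕ} : ∀ {F : ℂ → ℂ} {lam : Fin m → ℂ},
    DifferentiableOn ℂ F unitDisc → MapsTo F unitDisc unitDisc → Function.Injective lam →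
    (∀ j, lam j ∈ unitDisc) → (¬ ∃ h, IsStrictSelfMap h ∧ ∀ j, h (lam j) = F (lam j)) →
    ∃ k, 1 ≤ k ∧ k ≤ m - 1 ∧ IsBlaschkeOn F k := by
  induction m with
  | zero =>
    intro F lam _ _ _ _ hno
    exact absurd ⟨fun _ => 0, isStrictSelfMap_const (by simp), fun j => j.elim0⟩ hno
  | succ m ih =>
    intro F lam hF hmaps hinj hlam hno
    have h0 := mem_unitDisc.mp (hlam 0)
    have hb := mem_unitDisc.mp (hmaps (hlam 0))
    have hnb : ‖-F (lam 0)‖ < 1 := by rwa [norm_neg]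
    have hm : 1 ≤ m := by
      rw [Nat.one_le_iff_ne_zero]
      rintro rfl
      exact hno ⟨fun _ => F (lam 0), isStrictSelfMap_const hb, fun j => by rw [Fin.fin_one_eq_zero j]⟩
    obtain ⟨G, hGd, hG1, hFG⟩ := exists_eq_mobius_mul
      ((differentiableOn_mobius hb).comp hF hmaps) ((mapsTo_mobius hb).comp hmaps) (hlam 0)
      (mobius_self _)
    have hFeq : ∀ z ∈ unitDisc, F z = mobius (-F (lam 0)) (mobius (lam 0) z * G z) := fun z hz => by
      rw [← hFG z hz, Function.comp_apply, mobius_neg_mobius hb (mem_unitDisc.mp (hmaps hz)).le]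
    have hlift : ∀ {k}, IsBlaschkeOn G k → IsBlaschkeOn F (k + 1) := fun hk =>
      ((hk.of_mul_mobius h0 fun _ _ => rfl).mobius_comp hnb).congr hFeq
    by_cases hex : ∃ z ∈ unitDisc, ‖G z‖ = 1
    · obtain ⟨p, hp, hp1⟩ := hex
      have hconst := Complex.eqOn_of_isPreconnected_of_isMaxOn_norm
        (convex_ball (0 : ℂ) 1).isPreconnected isOpen_ball hGd hp
        (fun z hz => (hG1 z hz).trans_eq hp1.symm)
      refine ⟨1, le_rfl, by omega, hlift (k := 0) ⟨G p, fun j => j.elim0, hp1, fun j => j.elim0,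
        fun z hz => ?_⟩⟩
      simpa using hconst hz
    · push Not at hex
      have hGmaps : MapsTo G unitDisc unitDisc := fun z hz =>
        mem_unitDisc.mpr ((hG1 z hz).lt_of_ne (hex z hz))
      obtain ⟨k, -, hkm, hGk⟩ := ih (lam := fun j => lam j.succ) hGd hGmaps
        (hinj.comp (Fin.succ_injective _)) (fun j => hlam j.succ) (by
          rintro ⟨h, hh, hhG⟩
          refine hno ⟨_, (hh.mobius_mul h0).mobius_comp hnb, Fin.cases ?_ fun j => ?_⟩
          · simp
          · simp only [hhG j]
            exact (hFeq _ (hlam j.succ)).symm)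
      exact ⟨k + 1, by omega, by omega, hlift hGk⟩

lemma deriv_ne_zero_of_isLocalHomeomorph {P : ℂ → ℂ} (hP : DifferentiableOn ℂ P unitDisc)
    (hloc : IsLocalHomeomorph fun z : unitDisc => P z) {w : ℂ} (hw : w ∈ unitDisc) :
    deriv P w ≠ 0 := by
  obtain ⟨e, hwe, he⟩ := hloc ⟨w, hw⟩
  have heP : ∀ z : unitDisc, e z = P z := fun z => (congrFun he z).symm
  have hPd : ∀ z ∈ unitDisc, HasDerivAt P (deriv P z) z := fun z hz =>
    (hP.differentiableAt (isOpen_unitDisc.mem_nhds hz)).hasDerivAt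
  set σ : ℂ → ℂ := fun y => e.symm y with hσ
  have hx : P w ∈ e.target := heP ⟨w, hw⟩ ▸ e.map_source hwe
  have hσw : σ (P w) = w := by
    simp only [hσ, ← heP ⟨w, hw⟩, e.left_inv hwe]
  have hright : ∀ y ∈ e.target, P (σ y) = y := fun y hy => by
    rw [hσ, ← heP, e.right_inv hy]
  have htarget : ∀ y ∈ e.target, e.target ∈ nhds y := fun y hy => e.open_target.mem_nhds hy
  have hcont : ∀ y ∈ e.target, ContinuousAt σ y := fun y hy =>
    continuous_subtype_val.continuousAt.comp (e.continuousAt_symm hy)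
  have hdiff : ∀ y ∈ e.target, deriv P (σ y) ≠ 0 → DifferentiableAt ℂ σ y := fun y hy hne =>
    (HasDerivAt.of_local_left_inverse (hcont y hy) (hPd _ (e.symm y).2) hne
      (by filter_upwards [htarget y hy] with u hu using hright u hu)).differentiableAt
  have hderiv : AnalyticAt ℂ (deriv P) w :=
    (hP.analyticAt (isOpen_unitDisc.mem_nhds hw)).deriv
  rcases hderiv.eventually_eq_zero_or_eventually_ne_zero with h | h
  · exfalso
    have hpre : ∀ᶠ y in nhds (P w), deriv P (σ y) = 0 := by
      have := hcont _ hx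
      rw [ContinuousAt, hσw] at this
      exact this.eventually h
    obtain ⟨r, hr, hball⟩ := Metric.eventually_nhds_iff_ball.mp
      (h.and (isOpen_unitDisc.mem_nhds hw))
    have hconst : ∀ z ∈ ball w r, P z = P w := fun z hz =>
      isOpen_ball.is_const_of_deriv_eq_zero (convex_ball w r).isPreconnected
        (fun z hz => (hPd z (hball z hz).2).differentiableAt.differentiableWithinAt)
        (fun z hz => (hball z hz).1) hz (mem_ball_self hr)
    have hev : ∀ᶠ y in nhds (P w), y = P w := by
      have := hcont _ hx
      rw [ContinuousAt, hσw] at this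
      filter_upwards [this.eventually (ball_mem_nhds w hr), htarget _ hx] with y hy hyt
      rw [← hright y hyt, hconst _ hy]
    have hbot : (nhdsWithin (P w) {P w}ᶜ) = ⊥ := by
      rw [← Filter.eventually_false_iff_eq_bot, eventually_nhdsWithin_iff]
      filter_upwards [hev] with y hy hne using hne hy
    exact (inferInstance : (nhdsWithin (P w) {P w}ᶜ).NeBot).ne hbot
  · have hσa : AnalyticAt ℂ σ (P w) := by
      refine analyticAt_of_differentiable_on_punctured_nhds_of_continuousAt ?_ (hcont _ hx)
      have hc := hcont _ hx
      rw [ContinuousAt, hσw] at hc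
      rw [eventually_nhdsWithin_iff] at h ⊢
      filter_upwards [hc.eventually h, htarget _ hx] with y hy hyt hne
      refine hdiff y hyt (hy fun h => hne ?_)
      rw [← hright y hyt, mem_singleton_iff.mp h]; rfl
    have hcomp : HasDerivAt (fun y => P (σ y)) (deriv P w * deriv σ (P w)) (P w) :=
      HasDerivAt.comp (P w) (by rw [hσw]; exact hPd w hw) hσa.differentiableAt.hasDerivAt
    have hid : HasDerivAt (fun y => P (σ y)) 1 (P w) :=
      (hasDerivAt_id (P w)).congr_of_eventuallyEq
        (by filter_upwards [htarget _ hx] with y hy using hright y hy)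
    exact left_ne_zero_of_mul_eq_one (hcomp.unique hid)

lemma exists_injOn_ball_of_isLocalHomeomorph {P : ℂ → ℂ}
    (hloc : IsLocalHomeomorph fun z : unitDisc => P z) {w : ℂ} (hw : w ∈ unitDisc) :
    ∃ ε > 0, InjOn P (ball w ε ∩ unitDisc) := by
  obtain ⟨e, hwe, he⟩ := hloc ⟨w, hw⟩
  obtain ⟨ε, hε, hball⟩ := Metric.isOpen_iff.mp e.open_source _ hwe
  refine ⟨ε, hε, fun x hx y hy hxy => ?_⟩
  have hs : ∀ z (hz : z ∈ ball w ε ∩ unitDisc), (⟨z, hz.2⟩ : unitDisc) ∈ e.source :=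
    fun z hz => hball hz.1
  have := e.injOn (hs x hx) (hs y hy) (by rw [← he]; exact hxy)
  exact congrArg Subtype.val this

section Covering

variable {D : Set ℂ} {P : ℂ → ℂ} {hPmaps : MapsTo P unitDisc D}

lemma isLocalHomeomorph_of_isCoveringMap (hDo : IsOpen D)
    (hcov : IsCoveringMap (hPmaps.restrict P unitDisc D)) :
    IsLocalHomeomorph fun z : unitDisc => P z :=
  hDo.isOpenEmbedding_subtypeVal.isLocalHomeomorph.comp hcov.isLocalHomeomorph

lemma exists_holomorphic_lift (hDo : IsOpen D) (hP : DifferentiableOn ℂ P unitDisc)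
    (hcov : IsCoveringMap (hPmaps.restrict P unitDisc D)) {V : Set ℂ} (hVo : IsOpen V)
    (hVc : Convex ℝ V) {g : ℂ → ℂ} (hg : DifferentiableOn ℂ g V) (hgD : MapsTo g V D)
    {a w : ℂ} (ha : a ∈ V) (hw : w ∈ unitDisc) (haw : P w = g a) :
    ∃ F : ℂ → ℂ, DifferentiableOn ℂ F V ∧ MapsTo F V unitDisc ∧ F a = w ∧
      ∀ z ∈ V, P (F z) = g z := by
  classical
  have : ContractibleSpace V := hVc.contractibleSpace ⟨a, ha⟩
  have : LocallyPathConnectedSpace V := hVo.locallyPathConnectedSpace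
  obtain ⟨Φ, ⟨hΦa, hΦ⟩, -⟩ := hcov.existsUnique_continuousMap_lifts
    ⟨hgD.restrict g V D, hg.continuousOn.mapsToRestrict hgD⟩ ⟨a, ha⟩ ⟨w, hw⟩ (Subtype.ext haw)
  set F : ℂ → ℂ := fun z => if hz : z ∈ V then Φ ⟨z, hz⟩ else 0 with hF
  have hFΦ : ∀ z (hz : z ∈ V), F z = Φ ⟨z, hz⟩ := fun z hz => dif_pos hz
  have hmaps : MapsTo F V unitDisc := fun z hz => by
    rw [hFΦ z hz]; exact (Φ ⟨z, hz⟩).2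
  have hlift : ∀ z ∈ V, P (F z) = g z := fun z hz => by
    rw [hFΦ z hz]; exact congrArg Subtype.val (congrFun hΦ ⟨z, hz⟩)
  have hcont : ContinuousOn F V := by
    rw [continuousOn_iff_continuous_domRestrict]
    refine (continuous_subtype_val.comp Φ.continuous).congr fun z => ?_
    exact (hFΦ z z.2).symm
  refine ⟨F, fun z hz => ?_, hmaps, by rw [hFΦ a ha, hΦa], hlift⟩
  have hz' := hVo.mem_nhds hz
  exact (HasDerivAt.of_comp_left (hcont.continuousAt hz')
    (hP.differentiableAt (isOpen_unitDisc.mem_nhds (hmaps hz))).hasDerivAt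
    (hg.differentiableAt hz').hasDerivAt
    (deriv_ne_zero_of_isLocalHomeomorph hP (isLocalHomeomorph_of_isCoveringMap hDo hcov) (hmaps hz))
    (by filter_upwards [hz'] with y hy using
      hlift y hy)).differentiableAt.differentiableWithinAt

lemma eqOn_of_comp_eqOn (hcov : IsCoveringMap (hPmaps.restrict P unitDisc D)) {F G : ℂ → ℂ}
    (hF : ContinuousOn F unitDisc) (hG : ContinuousOn G unitDisc)
    (hFm : MapsTo F unitDisc unitDisc) (hGm : MapsTo G unitDisc unitDisc)
    (h : ∀ z ∈ unitDisc, P (F z) = P (G z)) {a : ℂ} (ha : a ∈ unitDisc) (haeq : F a = G a) :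
    EqOn F G unitDisc := by
  have : PreconnectedSpace unitDisc :=
    isPreconnected_iff_preconnectedSpace.mp (convex_ball (0 : ℂ) 1).isPreconnected
  have := hcov.eq_of_comp_eq (hF.mapsToRestrict hFm) (hG.mapsToRestrict hGm)
    (funext fun z => Subtype.ext (h z z.2)) ⟨a, ha⟩ (Subtype.ext haeq)
  exact fun z hz => congrArg Subtype.val (congrFun this ⟨z, hz⟩)

lemma surjective_of_isCoveringMap (hDc : IsConnected D)
    (hcov : IsCoveringMap (hPmaps.restrict P unitDisc D)) :
    Function.Surjective (hPmaps.restrict P unitDisc D) := by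
  have : PreconnectedSpace D := isPreconnected_iff_preconnectedSpace.mp hDc.isPreconnected
  rw [← range_eq_univ]
  refine IsClopen.eq_univ ⟨?_, hcov.isOpenMap.isOpen_range⟩
    ⟨_, mem_range_self ⟨0, mem_unitDisc.mpr (by simp)⟩⟩
  rw [← isOpen_compl_iff, isOpen_iff_mem_nhds]
  intro y hy
  obtain ⟨-, U, hyU, hU, -, H, -⟩ := hcov y
  filter_upwards [hU.mem_nhds hyU]
  rintro _ hx ⟨x, rfl⟩
  exact hy ⟨_, (H ⟨x, hx⟩).2.2⟩

lemma simplyConnectedSpace_of_injOn (hDc : IsConnected D)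
    (hcov : IsCoveringMap (hPmaps.restrict P unitDisc D)) (hinj : InjOn P unitDisc) :
    SimplyConnectedSpace D := by
  have : ContractibleSpace unitDisc :=
    (convex_ball (0 : ℂ) 1).contractibleSpace ⟨0, mem_ball_self one_pos⟩
  have hhom : IsHomeomorph (hPmaps.restrict P unitDisc D) :=
    ⟨hcov.continuous, hcov.isOpenMap,
      fun x y h => Subtype.ext (hinj x.2 y.2 (congrArg Subtype.val h)),
      surjective_of_isCoveringMap hDc hcov⟩
  exact (hhom.homeomorph _).symm.toHomotopyEquiv.simplyConnectedSpace

end Covering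

lemma inv_one_sub_normSq_mobius {e z : ℂ} (he : ‖e‖ < 1) (hz : ‖z‖ < 1) :
    (1 - ‖mobius e z‖ ^ 2)⁻¹ =
      ‖1 - (starRingEnd ℂ) e * z‖ ^ 2 / (1 - ‖e‖ ^ 2) / (1 - ‖z‖ ^ 2) := by
  have h := normSq_one_sub_conj_mul_sub e z
  have hd := norm_pos_iff.mpr (one_sub_conj_mul_ne_zero he hz.le)
  have : 1 - ‖mobius e z‖ ^ 2 =
      (1 - ‖e‖ ^ 2) * (1 - ‖z‖ ^ 2) / ‖1 - (starRingEnd ℂ) e * z‖ ^ 2 := by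
    rw [← h, mobius, norm_div, div_pow, sub_div, div_self (by positivity)]
  rw [this, inv_div, div_div]

lemma normSq_midpoint (u v : ℂ) :
    ‖(u + v) / 2‖ ^ 2 = (‖u‖ ^ 2 + ‖v‖ ^ 2) / 2 - ‖u - v‖ ^ 2 / 4 := by
  have h := parallelogram_law_with_norm ℝ u v
  rw [norm_div, div_pow, Complex.norm_ofNat]
  linarith

/-- A holomorphic self-map of the disc permuting a nonempty finite set has a fixed point: the
hyperbolic barycenter of the set. -/
lemma exists_fixedPoint_of_mapsTo_finset {G : ℂ → ℂ} (hG : DifferentiableOn ℂ G unitDisc)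
    (hGm : MapsTo G unitDisc unitDisc) {E : Finset ℂ} (hne : E.Nonempty)
    (hE : ∀ e ∈ E, e ∈ unitDisc) (hGE : ∀ e ∈ E, G e ∈ E) (hinj : InjOn G E) :
    ∃ z ∈ unitDisc, G z = z := by
  have hE' : ∀ e ∈ E, ‖e‖ < 1 := fun e he => mem_unitDisc.mp (hE e he)
  have hpos : ∀ {x : ℂ}, ‖x‖ < 1 → 0 < 1 - ‖x‖ ^ 2 := fun {x} hx => by
    nlinarith [norm_nonneg x]
  set S : ℂ → ℝ := fun z => ∑ e ∈ E, ‖1 - (starRingEnd ℂ) e * z‖ ^ 2 / (1 - ‖e‖ ^ 2) with hS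
  have hSpos : ∀ z, ‖z‖ ≤ 1 → 0 < S z := fun z hz =>
    Finset.sum_pos (fun e he => div_pos
      (pow_pos (norm_pos_iff.mpr (one_sub_conj_mul_ne_zero (hE' e he) hz)) 2) (hpos (hE' e he))) hne
  have hScont : Continuous S := by fun_prop
  have hSmid : ∀ u v, S ((u + v) / 2) ≤ (S u + S v) / 2 := by
    intro u v
    simp only [hS, ← Finset.sum_add_distrib, Finset.sum_div]
    refine Finset.sum_le_sum fun e he => ?_
    rw [← add_div, div_right_comm]
    refine div_le_div_of_nonneg_right ?_ (hpos (hE' e he)).le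
    have : 1 - (starRingEnd ℂ) e * ((u + v) / 2) =
        ((1 - (starRingEnd ℂ) e * u) + (1 - (starRingEnd ℂ) e * v)) / 2 := by ring
    rw [this, normSq_midpoint]
    have := sq_nonneg ‖(1 - (starRingEnd ℂ) e * u) - (1 - (starRingEnd ℂ) e * v)‖
    linarith
  have hcontr : ∀ z, ‖z‖ < 1 → S (G z) / (1 - ‖G z‖ ^ 2) ≤ S z / (1 - ‖z‖ ^ 2) := by
    intro z hz
    have hzd := mem_unitDisc.mpr hz
    have hGz := mem_unitDisc.mp (hGm hzd)
    have himage : E.image G = E :=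
      Finset.eq_of_subset_of_card_le (Finset.image_subset_iff.mpr hGE)
        (Finset.card_image_of_injOn hinj).ge
    have h1 : S (G z) = ∑ e ∈ E, ‖1 - (starRingEnd ℂ) (G e) * G z‖ ^ 2 / (1 - ‖G e‖ ^ 2) := by
      simp only [hS]
      conv_lhs => rw [← himage]
      exact Finset.sum_image hinj
    rw [h1, hS, Finset.sum_div, Finset.sum_div]
    refine Finset.sum_le_sum fun e he => ?_
    rw [← inv_one_sub_normSq_mobius (hE' _ (hGE e he)) hGz, ← inv_one_sub_normSq_mobius (hE' e he) hz]
    have hsp := norm_mobius_le_of_mapsTo hG hGm (hE e he) hzd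
    exact inv_anti₀ (hpos (norm_mobius_lt_one (hE' e he) hz)) (by gcongr)
  obtain ⟨p, hp, hmax⟩ := (isCompact_closedBall (0 : ℂ) 1).exists_isMaxOn
    (f := fun z => (1 - ‖z‖ ^ 2) / S z) ⟨0, by simp⟩
    (ContinuousOn.div (by fun_prop) hScont.continuousOn
      fun z hz => (hSpos z (by simpa using hz)).ne')
  rw [mem_closedBall_zero_iff] at hp
  have hmax' : ∀ z, ‖z‖ ≤ 1 → (1 - ‖z‖ ^ 2) / S z ≤ (1 - ‖p‖ ^ 2) / S p := fun z hz =>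
    hmax (by simpa using hz : z ∈ closedBall (0 : ℂ) 1)
  set M := (1 - ‖p‖ ^ 2) / S p with hM
  have hMpos : 0 < M := lt_of_lt_of_le (div_pos (by simp) (hSpos 0 (by simp)))
    (hmax' 0 (by simp))
  have hp1 : ‖p‖ < 1 := by
    refine hp.lt_of_ne fun h => ?_
    rw [hM, h] at hMpos
    simp at hMpos
  have hGp := mem_unitDisc.mp (hGm (mem_unitDisc.mpr hp1))
  refine ⟨p, mem_unitDisc.mpr hp1, ?_⟩
  by_contra hGpne
  have e1 : 1 - ‖p‖ ^ 2 = M * S p := by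
    rw [hM, div_mul_cancel₀ _ (hSpos p hp).ne']
  have e2 : M * S (G p) ≤ 1 - ‖G p‖ ^ 2 := by
    have h := hcontr p hp1
    rw [div_le_div_iff₀ (hpos hGp) (hpos hp1), e1] at h
    have := hSpos p hp
    nlinarith
  have hmid : ‖(p + G p) / 2‖ ≤ 1 := by
    rw [norm_div, Complex.norm_ofNat, div_le_one two_pos]
    linarith [norm_add_le p (G p)]
  have e3 := hmax' _ hmid
  rw [div_le_iff₀ (hSpos _ hmid), normSq_midpoint] at e3
  have e4 := mul_le_mul_of_nonneg_left (hSmid p (G p)) hMpos.le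
  have e5 : 0 < ‖p - G p‖ ^ 2 := pow_pos (norm_pos_iff.mpr (sub_ne_zero.mpr (Ne.symm hGpne))) 2
  linarith

section Covering

variable {D : Set ℂ} {P : ℂ → ℂ} {hPmaps : MapsTo P unitDisc D}

lemma infinite_fiber (hDo : IsOpen D) (hP : DifferentiableOn ℂ P unitDisc)
    (hcov : IsCoveringMap (hPmaps.restrict P unitDisc D)) {u v : ℂ} (hu : u ∈ unitDisc)
    (hv : v ∈ unitDisc) (huv : u ≠ v) (hPuv : P u = P v) :
    {z ∈ unitDisc | P z = P u}.Infinite := by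
  intro hfin
  have hconv : Convex ℝ unitDisc := convex_ball (0 : ℂ) 1
  obtain ⟨G, hG, hGm, hGu, hPG⟩ := exists_holomorphic_lift hDo hP hcov isOpen_unitDisc hconv hP
    hPmaps hu hv hPuv.symm
  obtain ⟨G', hG', hGm', hGv', hPG'⟩ := exists_holomorphic_lift hDo hP hcov isOpen_unitDisc hconv hP
    hPmaps hv hu hPuv
  have hleft : EqOn (G' ∘ G) id unitDisc :=
    eqOn_of_comp_eqOn hcov (hG'.continuousOn.comp hG.continuousOn hGm) continuousOn_id
      (hGm'.comp hGm) (mapsTo_id _) (fun z hz => by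
        rw [Function.comp_apply, hPG' _ (hGm hz), hPG z hz, id]) hu
      (by rw [Function.comp_apply, hGu, hGv', id])
  have hmem : ∀ z, z ∈ hfin.toFinset ↔ z ∈ unitDisc ∧ P z = P u := fun z => by simp
  obtain ⟨z, hz, hGz⟩ := exists_fixedPoint_of_mapsTo_finset hG hGm (E := hfin.toFinset)
    ⟨u, (hmem u).mpr ⟨hu, rfl⟩⟩ (fun e he => ((hmem e).mp he).1)
    (fun e he => by
      obtain ⟨h1, h2⟩ := (hmem e).mp he
      exact (hmem _).mpr ⟨hGm h1, (hPG e h1).trans h2⟩)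
    (fun e he e' he' h => (hleft ((hmem e).mp he).1).symm.trans
      ((congrArg G' h).trans (hleft ((hmem e').mp he').1)))
  have hid : EqOn G id unitDisc := eqOn_of_comp_eqOn hcov hG.continuousOn continuousOn_id hGm
    (mapsTo_id _) hPG hz hGz
  exact huv ((hid hu).symm.trans hGu)

lemma IsStrictSelfMap.not_weakExtremalFor (hP : DifferentiableOn ℂ P unitDisc)
    (hPmaps : MapsTo P unitDisc D) {h : ℂ → ℂ} (hh : IsStrictSelfMap h) {f : ℂ → ℂ} {m : ℕ}
    {lam : Fin m → ℂ} (hf : ∀ j, P (h (lam j)) = f (lam j)) : ¬ WeakExtremalFor D f lam := by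
  refine fun hw => hw ⟨{z | AnalyticAt ℂ h z} ∩ h ⁻¹' unitDisc, P ∘ h, ?_, ?_, ?_, ?_, hf⟩
  · exact ContinuousOn.isOpen_inter_preimage (fun z hz => (AnalyticAt.continuousAt hz).continuousWithinAt)
      (isOpen_analyticAt ℂ h) isOpen_unitDisc
  · exact fun z hz => ⟨hh.1 z hz, mem_unitDisc.mpr (hh.2 z (by simpa using hz))⟩
  · exact hP.comp (fun z hz => AnalyticAt.differentiableWithinAt hz.1) fun z hz => hz.2
  · exact fun z hz => hPmaps hz.2

/-- Lifting to the disc of a map into `D` holomorphic near the closed unit disc. -/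
lemma exists_isStrictSelfMap_lift (hDo : IsOpen D) (hP : DifferentiableOn ℂ P unitDisc)
    (hcov : IsCoveringMap (hPmaps.restrict P unitDisc D)) {U : Set ℂ} (hU : IsOpen U)
    (hcU : closedBall 0 1 ⊆ U) {h : ℂ → ℂ} (hh : DifferentiableOn ℂ h U) (hhD : MapsTo h U D)
    {a w : ℂ} (ha : a ∈ unitDisc) (hw : w ∈ unitDisc) (haw : P w = h a) :
    ∃ H, IsStrictSelfMap H ∧ H a = w ∧ ∀ z ∈ unitDisc, P (H z) = h z := by
  obtain ⟨δ, hδ, hsub⟩ := (isCompact_closedBall (0 : ℂ) 1).exists_thickening_subset_open hU hcU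
  rw [thickening_closedBall hδ zero_le_one] at hsub
  have hcb : closedBall (0 : ℂ) 1 ⊆ ball 0 (δ + 1) := closedBall_subset_ball (by linarith)
  have hdb : unitDisc ⊆ ball 0 (δ + 1) := unitDisc_subset_closedBall.trans hcb
  obtain ⟨H, hH, hHm, hHa, hPH⟩ := exists_holomorphic_lift hDo hP hcov isOpen_ball
    (convex_ball (0 : ℂ) (δ + 1)) (hh.mono hsub) (hhD.mono_left hsub) (hdb ha) hw haw
  exact ⟨H, ⟨fun z hz => hH.analyticAt (isOpen_ball.mem_nhds (hcb hz)),
    fun z hz => mem_unitDisc.mp (hHm (hcb (by simpa using hz)))⟩, hHa, fun z hz => hPH z (hdb hz)⟩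

lemma dist_le_two_mul_of_mapsTo {F : ℂ → ℂ} (hF : DifferentiableOn ℂ F unitDisc)
    (hFm : MapsTo F unitDisc unitDisc) {z : ℂ} (hz : z ∈ unitDisc) :
    dist (F z) (F 0) ≤ 2 * ‖z‖ := by
  have h0 := mem_unitDisc.mp (hFm (mem_unitDisc.mpr (by simp : ‖(0 : ℂ)‖ < 1)))
  have h := Complex.dist_le_div_mul_dist_of_mapsTo_ball (c := 0) (R₁ := 1) (R₂ := 2) hF
    (fun y hy => by
      rw [mem_closedBall, dist_eq_norm]
      linarith [norm_sub_le (F y) (F 0), mem_unitDisc.mp (hFm hy)]) hz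
  simpa using h

lemma isWeakExtremal_of_isBlaschkeOn (hDo : IsOpen D) (hP : DifferentiableOn ℂ P unitDisc)
    (hcov : IsCoveringMap (hPmaps.restrict P unitDisc D)) {m k : ℕ} (hk : 1 ≤ k) (hkm : k + 1 ≤ m)
    {f B : ℂ → ℂ} (hB : IsBlaschkeOn B k) (hf : ∀ z ∈ unitDisc, f z = P (B z)) :
    IsWeakExtremal D f m := by
  have hBd := hB.differentiableOn
  have hBm := hB.mapsTo hk
  have h0 : (0 : ℂ) ∈ unitDisc := mem_unitDisc.mpr (by simp)
  obtain ⟨ε, hε, hinj⟩ := exists_injOn_ball_of_isLocalHomeomorph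
    (isLocalHomeomorph_of_isCoveringMap hDo hcov) (hBm h0)
  have hm0 : (0 : ℝ) < m := by exact_mod_cast (by omega : 0 < m)
  obtain ⟨t, ht, ht1, htε⟩ : ∃ t : ℝ, 0 < t ∧ t * m ≤ 1 ∧ t * m ≤ ε / 2 := by
    refine ⟨min 1 (ε / 2) / m, by positivity, ?_, ?_⟩ <;> rw [div_mul_cancel₀ _ hm0.ne']
    exacts [min_le_left _ _, min_le_right _ _]
  set lam : Fin m → ℂ := fun j => ((t * (j : ℕ) : ℝ) : ℂ) with hlam
  have hnorm : ∀ j, ‖lam j‖ < t * m := fun j => by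
    rw [hlam, Complex.norm_of_nonneg (by positivity)]
    exact mul_lt_mul_of_pos_left (by exact_mod_cast j.2) ht
  have hlaminj : Function.Injective lam := fun i j hij => by
    simp only [hlam, Complex.ofReal_inj] at hij
    exact Fin.ext (by exact_mod_cast mul_left_cancel₀ ht.ne' hij)
  have hlamd : ∀ j, lam j ∈ unitDisc := fun j => mem_unitDisc.mpr ((hnorm j).trans_le ht1)
  refine ⟨lam, hlaminj, hlamd, ?_⟩
  rintro ⟨U, h, hU, hcU, hh, hhD, hint⟩
  have hlam0 : lam ⟨0, by omega⟩ = 0 := by simp [hlam]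
  obtain ⟨H, hH, hH0, hPH⟩ := exists_isStrictSelfMap_lift hDo hP hcov hU hcU hh hhD h0 (hBm h0)
    (by rw [← hf 0 h0, ← hlam0, hint])
  have hHd : DifferentiableOn ℂ H unitDisc := hH.1.differentiableOn.mono unitDisc_subset_closedBall
  have hHm : MapsTo H unitDisc unitDisc := fun z hz =>
    mem_unitDisc.mpr (hH.2 z (mem_unitDisc.mp hz).le)
  have heq : ∀ j, H (lam j) = B (lam j) := fun j => by
    have hclose : ∀ {F : ℂ → ℂ}, DifferentiableOn ℂ F unitDisc → MapsTo F unitDisc unitDisc →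
        F 0 = B 0 → F (lam j) ∈ ball (B 0) ε ∩ unitDisc := fun {F} hF hFm hF0 => by
      refine ⟨?_, hFm (hlamd j)⟩
      rw [mem_ball, ← hF0]
      linarith [dist_le_two_mul_of_mapsTo hF hFm (hlamd j), hnorm j]
    refine hinj (hclose hHd hHm hH0) (hclose hBd hBm rfl) ?_
    rw [hPH _ (hlamd j), hint, hf _ (hlamd j)]
  exact hB.not_interpolated hH (hlaminj.comp (Fin.castLE_injective hkm)) (fun j => hlamd _)
    fun j => heq _

lemma exists_isBlaschkeOn_of_isWeakExtremal (hDo : IsOpen D) (hDc : IsConnected D)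
    (hP : DifferentiableOn ℂ P unitDisc) (hcov : IsCoveringMap (hPmaps.restrict P unitDisc D))
    {m : ℕ} {f : ℂ → ℂ} (hf : DifferentiableOn ℂ f unitDisc) (hfD : MapsTo f unitDisc D)
    (hw : IsWeakExtremal D f m) :
    ∃ (B : ℂ → ℂ) (k : ℕ), 1 ≤ k ∧ k ≤ m - 1 ∧ IsBlaschkeOn B k ∧
      ∀ z ∈ unitDisc, f z = P (B z) := by
  obtain ⟨lam, hinj, hlam, hext⟩ := hw
  have h0 : (0 : ℂ) ∈ unitDisc := mem_unitDisc.mpr (by simp)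
  obtain ⟨w, hw⟩ := surjective_of_isCoveringMap hDc hcov ⟨f 0, hfD h0⟩
  obtain ⟨F, hF, hFm, -, hPF⟩ := exists_holomorphic_lift hDo hP hcov isOpen_unitDisc
    (convex_ball (0 : ℂ) 1) hf hfD h0 w.2 (congrArg Subtype.val hw)
  obtain ⟨k, hk, hkm, hB⟩ := exists_isBlaschkeOn_of_not_interpolated hF hFm hinj hlam (by
    rintro ⟨h, hh, hint⟩
    exact hh.not_weakExtremalFor hP hPmaps (fun j => by rw [hint, hPF _ (hlam j)]) hext)
  exact ⟨F, k, hk, hkm, hB, fun z hz => (hPF z hz).symm⟩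

lemma not_isExtremal_of_isBlaschkeOn (hDo : IsOpen D) (hP : DifferentiableOn ℂ P unitDisc)
    (hcov : IsCoveringMap (hPmaps.restrict P unitDisc D)) (hninj : ¬ InjOn P unitDisc) {m k : ℕ}
    (hk : 1 ≤ k) {f B : ℂ → ℂ} (hB : IsBlaschkeOn B k) (hf : ∀ z ∈ unitDisc, f z = P (B z)) :
    ¬ IsExtremal D f m := by
  simp only [InjOn, not_forall] at hninj
  obtain ⟨u, hu, v, hv, hPuv, huv⟩ := hninj
  have hinf := infinite_fiber hDo hP hcov hu hv huv hPuv
  set w : ℕ ↪ {z ∈ unitDisc | P z = P u} := hinf.natEmbedding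
  choose lam hlam hBlam using fun j : Fin m =>
    hB.exists_eq hk (hB.mapsTo hk) (mem_unitDisc.mp (w j).2.1)
  have hinj : Function.Injective lam := fun i j hij => by
    have : (w i : ℂ) = w j := by rw [← hBlam i, ← hBlam j, hij]
    exact Fin.ext (w.injective (Subtype.ext this))
  refine fun hext => hext lam hinj hlam ⟨univ, fun _ => P u, isOpen_univ, subset_univ _,
    differentiableOn_const _, fun _ _ => hPmaps hu, fun j => ?_⟩
  rw [hf _ (hlam j), hBlam j, (w j).2.2]

end Covering

/-- Let `D ⊆ ℂ` be a non-simply connected domain admitting a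
holomorphic covering `Π : 𝔻 → D`. A holomorphic `f : 𝔻 → D` is a weak
`m`-extremal iff `f = Π ∘ B` for a non-constant Blaschke product `B` of degree
at most `m-1`; moreover no such `f` is an `m`-extremal. -/
theorem planar_weak_extremals_via_covering
    (D : Set ℂ) (hDo : IsOpen D) (hDc : IsConnected D)
    (hnsc : ¬ SimplyConnectedSpace D)
    (Pmap : ℂ → ℂ)
    (hPdiff : DifferentiableOn ℂ Pmap unitDisc)
    (hPmaps : Set.MapsTo Pmap unitDisc D)
    (hcov : IsCoveringMap (Set.MapsTo.restrict Pmap unitDisc D hPmaps))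
    (m : ℕ) (hm : 2 ≤ m)
    (f : ℂ → ℂ) (hf : DifferentiableOn ℂ f unitDisc)
    (hfD : Set.MapsTo f unitDisc D) :
    (IsWeakExtremal D f m ↔
      ∃ (B : ℂ → ℂ) (k : ℕ), 1 ≤ k ∧ k ≤ m - 1 ∧ IsBlaschkeOn B k ∧
        ∀ z ∈ unitDisc, f z = Pmap (B z)) ∧
    (IsWeakExtremal D f m → ¬ IsExtremal D f m) := by
  have hkm : ∀ {k}, k ≤ m - 1 → k + 1 ≤ m := fun h => by omega
  have hforward := exists_isBlaschkeOn_of_isWeakExtremal (m := m) hDo hDc hPdiff hcov hf hfD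
  refine ⟨⟨hforward, ?_⟩, fun hw => ?_⟩
  · rintro ⟨B, k, hk, hk', hB, hfB⟩
    exact isWeakExtremal_of_isBlaschkeOn hDo hPdiff hcov hk (hkm hk') hB hfB
  · obtain ⟨B, k, hk, -, hB, hfB⟩ := hforward hw
    exact not_isExtremal_of_isBlaschkeOn hDo hPdiff hcov
      (fun hinj => hnsc (simplyConnectedSpace_of_injOn hDc hcov hinj)) hk hB hfB
end
end
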